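/- arXiv:1606.00978 — 2 statements merged into one kernel-verified Lean document; each statement's English description precedes it below -/
import Mathlib

section
/- The trigonometric (XXZ-type) R-matrix satisfies the Yang–Baxter equation: for all λ₁, λ₂, λ₃ ∈ ℂ with sinh(λ₁−λ₂), sinh(λ₁−λ₃), sinh(λ₂−λ₃) all nonzero, R₁₂(λ₁,λ₂) R₁₃(λ₁,λ₃) R₂₃(λ₂,λ₃) = R₂₃(λ₂,λ₃) R₁₃(λ₁,λ₃) R₁₂(λ₁,λ₂) as linear maps on ℂ² ⊗ ℂ² ⊗ ℂ², where R_{kl}(λ,μ) acts as R(λ,μ) on the k-th and l-th tensor factors and as identity on the remaining one. -/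
open scoped BigOperators

noncomputable section

/-- The endomorphism algebra of a complex vector space `H`. -/
abbrev EndH (H : Type) [AddCommGroup H] [Module ℂ H] := Module.End ℂ H

/-- The 4×4 matrix `[[f,0,0,0],[0,1,g,0],[0,g,1,0],[0,0,0,f]]` acting on `ℂ² ⊗ ℂ²`,
indexed by `Fin 2 × Fin 2` (standard tensor basis). -/
def Rfg (f g : ℂ) : Matrix (Fin 2 × Fin 2) (Fin 2 × Fin 2) ℂ :=
  fun p q =>
    if p = q then (if p.1 = p.2 then f else 1)
    else if p.1 = q.2 ∧ p.2 = q.1 then g else 0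

/-- Rational function `f(λ,μ) = (λ-μ+1)/(λ-μ)`. -/
def fXXX (l m : ℂ) : ℂ := (l - m + 1) / (l - m)

/-- Rational function `g(λ,μ) = 1/(λ-μ)`. -/
def gXXX (l m : ℂ) : ℂ := 1 / (l - m)

/-- The rational (XXX-type) R-matrix. -/
def RXXX (l m : ℂ) : Matrix (Fin 2 × Fin 2) (Fin 2 × Fin 2) ℂ := Rfg (fXXX l m) (gXXX l m)

/-- Trigonometric `f(λ,μ) = sinh(λ-μ+η)/sinh(λ-μ)`. -/
def fXXZ (η l m : ℂ) : ℂ := Complex.sinh (l - m + η) / Complex.sinh (l - m)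

/-- Trigonometric `g(λ,μ) = sinh η / sinh(λ-μ)`. -/
def gXXZ (η l m : ℂ) : ℂ := Complex.sinh η / Complex.sinh (l - m)

/-- The trigonometric (XXZ-type) R-matrix with anisotropy `η`. -/
def RXXZ (η l m : ℂ) : Matrix (Fin 2 × Fin 2) (Fin 2 × Fin 2) ℂ :=
  Rfg (fXXZ η l m) (gXXZ η l m)

variable {H : Type} [AddCommGroup H] [Module ℂ H]

/-- `T₁(λ)`: the 2×2 operator matrix `T` acting in the first auxiliary space `ℂ²`
(and in `H`), identity in the second auxiliary space. -/
def aux1 (T : Matrix (Fin 2) (Fin 2) (EndH H)) :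
    Matrix (Fin 2 × Fin 2) (Fin 2 × Fin 2) (EndH H) :=
  fun p q => if p.2 = q.2 then T p.1 q.1 else 0

/-- `T₂(μ)`: the 2×2 operator matrix `T` acting in the second auxiliary space `ℂ²`
(and in `H`), identity in the first auxiliary space. -/
def aux2 (T : Matrix (Fin 2) (Fin 2) (EndH H)) :
    Matrix (Fin 2 × Fin 2) (Fin 2 × Fin 2) (EndH H) :=
  fun p q => if p.1 = q.1 then T p.2 q.2 else 0

/-- A scalar 4×4 matrix viewed as a matrix of endomorphisms of `H`
(i.e. `R ⊗ id_H` on `ℂ² ⊗ ℂ² ⊗ H`). -/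
def embedR (R : Matrix (Fin 2 × Fin 2) (Fin 2 × Fin 2) ℂ) :
    Matrix (Fin 2 × Fin 2) (Fin 2 × Fin 2) (EndH H) :=
  R.map (fun c => c • (1 : EndH H))

/-- The RTT relation `R₁₂(λ,μ) T₁(λ) T₂(μ) = T₂(μ) T₁(λ) R₁₂(λ,μ)` in
`End(ℂ² ⊗ ℂ² ⊗ H)`, for all `λ, μ ∈ Λ` which are admissible (`adm λ μ`). -/
def SatisfiesRTT (Λ : Set ℂ) (adm : ℂ → ℂ → Prop)
    (R : ℂ → ℂ → Matrix (Fin 2 × Fin 2) (Fin 2 × Fin 2) ℂ)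
    (T : ℂ → Matrix (Fin 2) (Fin 2) (EndH H)) : Prop :=
  ∀ lam mu : ℂ, lam ∈ Λ → mu ∈ Λ → adm lam mu →
    embedR (R lam mu) * aux1 (T lam) * aux2 (T mu)
      = aux2 (T mu) * aux1 (T lam) * embedR (R lam mu)

/-- Ordered product `∏_{k ∈ s} B k` of endomorphisms indexed by a finset of a linearly
ordered type, taken in increasing order of the index. -/
def finsetOpProd {ι : Type} [LinearOrder ι] (s : Finset ι) (B : ι → EndH H) : EndH H :=
  ((s.sort (· ≤ ·)).map B).prod


/-- `R₁₂`: a 4×4 matrix acting on factors 1 and 2 of `ℂ² ⊗ ℂ² ⊗ ℂ²`, identity on factor 3. -/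
def lift12 (R : Matrix (Fin 2 × Fin 2) (Fin 2 × Fin 2) ℂ) :
    Matrix (Fin 2 × Fin 2 × Fin 2) (Fin 2 × Fin 2 × Fin 2) ℂ :=
  fun p q => if p.2.2 = q.2.2 then R (p.1, p.2.1) (q.1, q.2.1) else 0

/-- `R₁₃`: a 4×4 matrix acting on factors 1 and 3 of `ℂ² ⊗ ℂ² ⊗ ℂ²`, identity on factor 2. -/
def lift13 (R : Matrix (Fin 2 × Fin 2) (Fin 2 × Fin 2) ℂ) :
    Matrix (Fin 2 × Fin 2 × Fin 2) (Fin 2 × Fin 2 × Fin 2) ℂ :=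
  fun p q => if p.2.1 = q.2.1 then R (p.1, p.2.2) (q.1, q.2.2) else 0

/-- `R₂₃`: a 4×4 matrix acting on factors 2 and 3 of `ℂ² ⊗ ℂ² ⊗ ℂ²`, identity on factor 1. -/
def lift23 (R : Matrix (Fin 2 × Fin 2) (Fin 2 × Fin 2) ℂ) :
    Matrix (Fin 2 × Fin 2 × Fin 2) (Fin 2 × Fin 2 × Fin 2) ℂ :=
  fun p q => if p.1 = q.1 then R (p.2.1, p.2.2) (q.2.1, q.2.2) else 0

set_option maxHeartbeats 1600000 in
/-- Three algebraic relations between the entries imply the Yang–Baxter equation for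
matrices of the form `Rfg f g`. -/
theorem lift_Rfg_yangBaxter {f g f' g' f'' g'' : ℂ}
    (h₁ : f * g' * f'' = g' + g * f' * g'')
    (h₂ : f * g'' = f' * g'' + g * g')
    (h₃ : g * f'' = g * f' + g' * g'') :
    lift12 (Rfg f g) * lift13 (Rfg f' g') * lift23 (Rfg f'' g'')
      = lift23 (Rfg f'' g'') * lift13 (Rfg f' g') * lift12 (Rfg f g) := by
  ext ⟨i, j, k⟩ ⟨i', j', k'⟩
  fin_cases i <;> fin_cases j <;> fin_cases k <;>
    fin_cases i' <;> fin_cases j' <;> fin_cases k' <;>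
    simp [Matrix.mul_apply, Fintype.sum_prod_type, lift12, lift13, lift23, Rfg] <;>
    grind

theorem sinh_add_mul_sinh (u v η : ℂ) :
    Complex.sinh (u + η) * Complex.sinh (u + v)
      = Complex.sinh (u + v + η) * Complex.sinh u + Complex.sinh η * Complex.sinh v := by
  simp only [Complex.sinh_add, Complex.cosh_add]
  have hu := Complex.cosh_sq u
  linear_combination Complex.sinh η * Complex.sinh v * hu

theorem sinh_mul_sinh_add_mul_sinh_add (u v η : ℂ) :
    Complex.sinh (u + η) * Complex.sinh (v + η)
      = Complex.sinh u * Complex.sinh v + Complex.sinh η * Complex.sinh (u + v + η) := by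
  simp only [Complex.sinh_add, Complex.cosh_add]
  have hη := Complex.cosh_sq η
  linear_combination Complex.sinh u * Complex.sinh v * hη

/-- the trigonometric (XXZ-type) R-matrix satisfies the Yang–Baxter
equation. -/
theorem XXZ_Yang_Baxter (eta l1 l2 l3 : ℂ)
    (h12 : Complex.sinh (l1 - l2) ≠ 0) (h13 : Complex.sinh (l1 - l3) ≠ 0)
    (h23 : Complex.sinh (l2 - l3) ≠ 0) :
    lift12 (RXXZ eta l1 l2) * lift13 (RXXZ eta l1 l3) * lift23 (RXXZ eta l2 l3)
      = lift23 (RXXZ eta l2 l3) * lift13 (RXXZ eta l1 l3) * lift12 (RXXZ eta l1 l2) := by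
  set u := l1 - l2 with hu
  set v := l2 - l3 with hv
  have huv : l1 - l3 = u + v := by rw [hu, hv]; ring
  rw [huv] at h13
  have hvu := sinh_add_mul_sinh v u eta
  rw [add_comm v u] at hvu
  apply lift_Rfg_yangBaxter <;> simp only [fXXZ, gXXZ, huv, ← hu, ← hv] <;> field_simp
  · linear_combination Complex.sinh eta * sinh_mul_sinh_add_mul_sinh_add u v eta
  · linear_combination Complex.sinh eta * sinh_add_mul_sinh u v eta
  · linear_combination Complex.sinh eta * hvu

end
end

section
/- (Two-component model, XXX case.) Let H be a complex vector space and for j = 1, 2 let Tⱼ(λ) = [[Aⱼ(λ),Bⱼ(λ)],[Cⱼ(λ),Dⱼ(λ)]] be monodromy matrices on H with common domain Λ ⊆ ℂ, each satisfying the RTT relation with the rational (XXX-type) R-matrix, such that every matrix entry of T₁(λ) commutes with every matrix entry of T₂(μ). Suppose there is a nonzero vector |0⟩ ∈ H and scalar functions aⱼ, dⱼ : Λ → ℂ with Aⱼ(λ)|0⟩ = aⱼ(λ)|0⟩, Dⱼ(λ)|0⟩ = dⱼ(λ)|0⟩ and Cⱼ(λ)|0⟩ = 0 for j = 1,2 and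 all λ ∈ Λ. Let B(λ) = A₁(λ)B₂(λ) + B₁(λ)D₂(λ) be the (1,2) entry of T(λ) = T₁(λ)T₂(λ). Then for any pairwise distinct λ₁, …, λ_M ∈ Λ: B(λ₁)⋯B(λ_M)|0⟩ = Σ_{J ⊆ {1,…,M}} ( ∏_{j∈J, k∉J} f(λⱼ,λ_k) ) ( ∏_{j∈J} d₂(λⱼ) ) ( ∏_{k∉J} a₁(λ_k) ) ( ∏_{j∈J} B₁(λⱼ) ) ( ∏_{k∉J} B₂(λ_k) ) |0⟩, where f(λ,μ) = (λ−μ+1)/(λ−μ), the sum is over all subsets J of {1,…,M} with complement J̄ = {1,…,M}∖J, and the products of B₁-operators (respectively B₂-operators) may be taken in any order since [Bⱼ(λ),Bⱼ(μ)] = 0. -/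
open scoped BigOperators

noncomputable section

variable {H : Type} [AddCommGroup H] [Module ℂ H]

section OrderedProducts

variable {ι : Type} [LinearOrder ι]

@[simp]
theorem finsetOpProd_empty (B : ι → EndH H) : finsetOpProd ∅ B = 1 := by
  simp [finsetOpProd]

theorem finsetOpProd_insert {B : ι → EndH H} (hB : ∀ i j, Commute (B i) (B j))
    {a : ι} {s : Finset ι} (ha : a ∉ s) :
    finsetOpProd (insert a s) B = B a * finsetOpProd s B := by
  have hperm : ((insert a s).sort (· ≤ ·)).Perm (a :: s.sort (· ≤ ·)) := by
    rw [List.perm_ext_iff_of_nodup (Finset.sort_nodup _ _)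
      (List.nodup_cons.2 ⟨by simpa using ha, Finset.sort_nodup _ _⟩)]
    simp
  have h := (hperm.map B).prod_eq' (List.pairwise_of_forall_mem_list fun x hx y hy => by
    obtain ⟨i, -, rfl⟩ := List.mem_map.1 hx
    obtain ⟨j, -, rfl⟩ := List.mem_map.1 hy
    exact hB i j)
  simpa [finsetOpProd] using h

theorem finsetOpProd_insert_of_lt {B : ι → EndH H} {a : ι} {s : Finset ι}
    (ha : ∀ x ∈ s, a < x) :
    finsetOpProd (insert a s) B = B a * finsetOpProd s B := by
  have h : (insert a s).sort (· ≤ ·) = a :: s.sort (· ≤ ·) :=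
    Finset.sort_insert _ (fun b hb => (ha b hb).le) fun h => (ha a h).false
  simp [finsetOpProd, h]

theorem finsetOpProd_commute {X : EndH H} {B : ι → EndH H} (hX : ∀ i, Commute X (B i))
    (s : Finset ι) : Commute X (finsetOpProd s B) := by
  refine Commute.list_prod_right _ _ fun y hy => ?_
  obtain ⟨i, -, rfl⟩ := List.mem_map.1 hy
  exact hX i

theorem prod_ofFn_eq_finsetOpProd_univ {M : ℕ} (B : Fin M → EndH H) :
    (List.ofFn B).prod = finsetOpProd Finset.univ B := by
  simp [finsetOpProd, List.ofFn_eq_map, Fin.sort_univ]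

/-- Action of an operator `A m`, having `v` as an eigenvector, on a product of commuting
operators `B j` applied to `v`, given exchange relations of Yang–Baxter type. -/
theorem exchange_action {A B : ι → EndH H} {v : H} {α : ι → ℂ} {f g : ι → ι → ℂ}
    (hB : ∀ i j, Commute (B i) (B j))
    (hAB : ∀ i j, i ≠ j → A i * B j = f i j • (B j * A i) + g i j • (B i * A j))
    (hfg : ∀ m k j, m ≠ k → m ≠ j → k ≠ j →
      g m j * f j k = f m k * g m j + g m k * g k j)
    (hv : ∀ i, A i v = α i • v) (s : Finset ι) :
    ∀ m ∉ s, A m (finsetOpProd s B v) =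
      (α m * ∏ j ∈ s, f m j) • finsetOpProd s B v +
      ∑ j ∈ s, (α j * g m j * ∏ i ∈ s.erase j, f j i) •
        B m (finsetOpProd (s.erase j) B v) := by
  induction s using Finset.induction_on with
  | empty => simp [hv]
  | insert k s hk ih =>
    intro m hm
    obtain ⟨hmk, hms⟩ : m ≠ k ∧ m ∉ s := by simpa using hm
    have hex : A m (B k (finsetOpProd s B v)) =
        f m k • B k (A m (finsetOpProd s B v)) + g m k • B m (A k (finsetOpProd s B v)) := by
      simpa using LinearMap.congr_fun (hAB m k hmk) (finsetOpProd s B v)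
    have herase : ∀ j ∈ s, (insert k s).erase j = insert k (s.erase j) := fun j hj =>
      Finset.erase_insert_of_ne (by rintro rfl; exact hk hj)
    have hterm : ∀ j ∈ s,
        (α j * g m j * ∏ i ∈ (insert k s).erase j, f j i) •
          B m (finsetOpProd ((insert k s).erase j) B v) =
        f m k • (α j * g m j * ∏ i ∈ s.erase j, f j i) •
          B k (B m (finsetOpProd (s.erase j) B v)) +
        g m k • (α j * g k j * ∏ i ∈ s.erase j, f j i) •
          B m (B k (finsetOpProd (s.erase j) B v)) := by
      intro j hj
      have hkj : k ∉ s.erase j := fun h => hk (Finset.mem_of_mem_erase h)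
      have hcomm : B k (B m (finsetOpProd (s.erase j) B v)) =
          B m (B k (finsetOpProd (s.erase j) B v)) :=
        LinearMap.congr_fun (hB k m).eq _
      rw [herase j hj, finsetOpProd_insert hB hkj, Finset.prod_insert hkj, hcomm,
        Module.End.mul_apply, smul_smul, smul_smul, ← add_smul]
      congr 1
      linear_combination (α j * ∏ i ∈ s.erase j, f j i) *
        hfg m k j hmk (by rintro rfl; exact hms hj) (by rintro rfl; exact hk hj)
    rw [Finset.sum_insert hk, Finset.sum_congr rfl hterm, Finset.erase_insert hk,
      finsetOpProd_insert hB hk, Finset.prod_insert hk, Module.End.mul_apply, hex,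
      ih m hms, ih k hk, Finset.sum_add_distrib]
    simp only [map_add, map_sum, map_smul, smul_add, Finset.smul_sum]
    module

end OrderedProducts

section TwoComponents

variable {ι : Type} [LinearOrder ι]

/-- The coefficient of `∏_{j ∈ J} B₁(λⱼ) ∏_{k ∈ K} B₂(λₖ)` in the two-component expansion. -/
def splitCoeff (f : ι → ι → ℂ) (a d : ι → ℂ) (J K : Finset ι) : ℂ :=
  (∏ j ∈ J, ∏ k ∈ K, f j k) * (∏ j ∈ J, d j) * ∏ k ∈ K, a k

theorem splitCoeff_insert_left (f : ι → ι → ℂ) (a d : ι → ℂ) {m : ι} {J : Finset ι}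
    (hm : m ∉ J) (K : Finset ι) :
    splitCoeff f a d (insert m J) K =
      splitCoeff f a d J K * (d m * ∏ k ∈ K, f m k) := by
  simp only [splitCoeff, Finset.prod_insert hm]
  ring

theorem splitCoeff_insert_right (f : ι → ι → ℂ) (a d : ι → ℂ) (J : Finset ι) {m : ι}
    {K : Finset ι} (hm : m ∉ K) :
    splitCoeff f a d J (insert m K) =
      splitCoeff f a d J K * (a m * ∏ j ∈ J, f j m) := by
  simp only [splitCoeff, Finset.prod_insert hm, Finset.prod_mul_distrib]
  ring

theorem sum_powerset_sum_mem_eq {E : Type} [AddCommMonoid E] (s : Finset ι)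
    (F : Finset ι → Finset ι → ι → E) :
    ∑ J ∈ s.powerset, ∑ j ∈ J, F (J.erase j) (s \ J) j =
      ∑ J ∈ s.powerset, ∑ k ∈ s \ J, F J ((s \ J).erase k) k := by
  rw [Finset.sum_sigma', Finset.sum_sigma']
  refine Finset.sum_nbij' (fun p => ⟨p.1.erase p.2, p.2⟩) (fun p => ⟨insert p.2 p.1, p.2⟩)
    ?_ ?_ ?_ ?_ ?_
  · rintro ⟨J, j⟩ h
    simp only [Finset.mem_sigma, Finset.mem_powerset, Finset.mem_sdiff] at h ⊢
    exact ⟨(Finset.erase_subset _ _).trans h.1, h.1 h.2, Finset.notMem_erase _ _⟩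
  · rintro ⟨J, j⟩ h
    simp only [Finset.mem_sigma, Finset.mem_powerset, Finset.mem_sdiff] at h ⊢
    exact ⟨Finset.insert_subset h.2.1 h.1, Finset.mem_insert_self _ _⟩
  · rintro ⟨J, j⟩ h
    simp only [Finset.mem_sigma] at h
    simp [Finset.insert_erase h.2]
  · rintro ⟨J, j⟩ h
    simp only [Finset.mem_sigma, Finset.mem_sdiff] at h
    simp [Finset.erase_insert h.2.2]
  · rintro ⟨J, j⟩ h
    simp only [Finset.mem_sigma, Finset.mem_powerset] at h
    have : (s \ J.erase j).erase j = s \ J := by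
      ext x
      by_cases hx : x = j
      · subst hx; simp [h.2]
      · simp [hx]
    simp [this]

/-- Two-component expansion of a product of the operators `A₁ B₂ + B₁ D₂` applied to a vacuum
vector, from the exchange relations of the components. -/
theorem finsetOpProd_two_component {A1 B1 B2 D2 : ι → EndH H} {v : H} {a d : ι → ℂ}
    {f g : ι → ι → ℂ}
    (hB1 : ∀ i j, Commute (B1 i) (B1 j)) (hB2 : ∀ i j, Commute (B2 i) (B2 j))
    (hA1B2 : ∀ i j, Commute (A1 i) (B2 j)) (hB1B2 : ∀ i j, Commute (B1 i) (B2 j))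
    (hD2B1 : ∀ i j, Commute (D2 i) (B1 j))
    (hA1 : ∀ i j, i ≠ j → A1 i * B1 j = f j i • (B1 j * A1 i) + g i j • (B1 i * A1 j))
    (hD2 : ∀ i j, i ≠ j → D2 i * B2 j = f i j • (B2 j * D2 i) + (-g i j) • (B2 i * D2 j))
    (hfgA : ∀ m k j, m ≠ k → m ≠ j → k ≠ j →
      g m j * f k j = f k m * g m j + g m k * g k j)
    (hfgD : ∀ m k j, m ≠ k → m ≠ j → k ≠ j →
      -g m j * f j k = f m k * -g m j + -g m k * -g k j)
    (hA1v : ∀ i, A1 i v = a i • v) (hD2v : ∀ i, D2 i v = d i • v) (s : Finset ι) :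
    finsetOpProd s (fun i => A1 i * B2 i + B1 i * D2 i) v =
      ∑ J ∈ s.powerset, splitCoeff f a d J (s \ J) •
        (finsetOpProd J B1 (finsetOpProd (s \ J) B2 v)) := by
  induction s using Finset.induction_on_min with
  | empty => simp [splitCoeff]
  | insert m s hlt ih =>
    have hm : m ∉ s := fun h => (hlt m h).false
    set F : Finset ι → Finset ι → ι → H := fun J K j =>
      (splitCoeff f a d J K * (d j * ∏ k ∈ K, f j k) * (a j * g m j * ∏ i ∈ J, f i j)) •
        B1 m (finsetOpProd J B1 (B2 m (finsetOpProd K B2 v))) with hF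
    have hstep : ∀ J ∈ s.powerset,
        (A1 m * B2 m + B1 m * D2 m) (splitCoeff f a d J (s \ J) •
          finsetOpProd J B1 (finsetOpProd (s \ J) B2 v)) =
        splitCoeff f a d J (insert m s \ J) •
          finsetOpProd J B1 (finsetOpProd (insert m s \ J) B2 v) +
        splitCoeff f a d (insert m J) (insert m s \ insert m J) •
          finsetOpProd (insert m J) B1 (finsetOpProd (insert m s \ insert m J) B2 v) +
        (∑ j ∈ J, F (J.erase j) (s \ J) j - ∑ k ∈ s \ J, F J ((s \ J).erase k) k) := by
      intro J hJ
      rw [Finset.mem_powerset] at hJ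
      have hmJ : m ∉ J := fun h => hm (hJ h)
      have hmK : m ∉ s \ J := fun h => hm (Finset.sdiff_subset h)
      have hK : insert m s \ J = insert m (s \ J) := Finset.insert_sdiff_of_notMem _ hmJ
      have hK' : insert m s \ insert m J = s \ J := by
        rw [Finset.insert_sdiff_insert, Finset.sdiff_insert_of_notMem hm]
      rw [hK, hK']
      generalize hKdef : s \ J = K at hmK
      have hw : ∀ i, A1 i (B2 m (finsetOpProd K B2 v)) =
          a i • B2 m (finsetOpProd K B2 v) := fun i => by
        have h := LinearMap.congr_fun
          ((hA1B2 i m).mul_right (finsetOpProd_commute (hA1B2 i) K)).eq v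
        simpa [hA1v] using h
      have hB2J : B2 m (finsetOpProd J B1 (finsetOpProd K B2 v)) =
          finsetOpProd J B1 (B2 m (finsetOpProd K B2 v)) :=
        LinearMap.congr_fun (finsetOpProd_commute (fun i => (hB1B2 i m).symm) J).eq _
      have hD2J : D2 m (finsetOpProd J B1 (finsetOpProd K B2 v)) =
          finsetOpProd J B1 (D2 m (finsetOpProd K B2 v)) :=
        LinearMap.congr_fun (finsetOpProd_commute (hD2B1 m) J).eq _
      have hFA : ∀ j ∈ J, F (J.erase j) K j = splitCoeff f a d J K •
          (a j * g m j * ∏ i ∈ J.erase j, f i j) •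
            B1 m (finsetOpProd (J.erase j) B1 (B2 m (finsetOpProd K B2 v))) := by
        intro j hj
        rw [← Finset.insert_erase hj, splitCoeff_insert_left _ _ _ (Finset.notMem_erase j J),
          Finset.insert_erase hj, smul_smul]
      have hFD : ∀ k ∈ K, F J (K.erase k) k = -(splitCoeff f a d J K •
          (d k * -g m k * ∏ i ∈ K.erase k, f k i) •
            B1 m (finsetOpProd J B1 (B2 m (finsetOpProd (K.erase k) B2 v)))) := by
        intro k hk
        rw [← Finset.insert_erase hk, splitCoeff_insert_right _ _ _ _ (Finset.notMem_erase k K),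
          Finset.insert_erase hk, smul_smul, ← neg_smul]
        simp only [hF]
        congr 1
        ring
      rw [Finset.sum_congr rfl hFA, Finset.sum_congr rfl hFD, map_smul, LinearMap.add_apply,
        Module.End.mul_apply, Module.End.mul_apply, hB2J, hD2J,
        exchange_action (f := fun i j => f j i) hB1 hA1 hfgA hw J m hmJ,
        exchange_action (g := fun i j => -g i j) hB2 hD2 hfgD hD2v K m hmK,
        finsetOpProd_insert hB1 hmJ, finsetOpProd_insert hB2 hmK,
        splitCoeff_insert_left _ _ _ hmJ, splitCoeff_insert_right _ _ _ _ hmK]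
      simp only [map_add, map_sum, map_smul, smul_add, ← Finset.smul_sum, Finset.sum_neg_distrib,
        Module.End.mul_apply]
      module
    rw [finsetOpProd_insert_of_lt hlt, Module.End.mul_apply, ih, map_sum,
      Finset.sum_congr rfl hstep, Finset.sum_add_distrib, Finset.sum_add_distrib,
      Finset.sum_sub_distrib, sum_powerset_sum_mem_eq s F, sub_self, add_zero,
      Finset.sum_powerset_insert hm]

end TwoComponents

section RationalRTT

theorem fXXX_eq_one_add_gXXX {l m : ℂ} (h : l ≠ m) : fXXX l m = 1 + gXXX l m := by
  have := sub_ne_zero.2 h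
  simp only [fXXX, gXXX]
  field_simp

theorem gXXX_mul_gXXX {l m n : ℂ} (hlm : l ≠ m) (hln : l ≠ n) (hmn : m ≠ n) :
    gXXX l m * gXXX m n = gXXX l n * (gXXX l m + gXXX m n) := by
  have h1 := sub_ne_zero.2 hlm
  have h2 := sub_ne_zero.2 hln
  have h3 := sub_ne_zero.2 hmn
  simp only [gXXX]
  field_simp
  ring

theorem gXXX_swap (l m : ℂ) : gXXX m l = -gXXX l m := by
  simp only [gXXX, ← neg_sub l m, one_div, inv_neg]

variable {Λ : Set ℂ} {T : ℂ → Matrix (Fin 2) (Fin 2) (EndH H)} {l m : ℂ}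

theorem SatisfiesRTT.one_one_mul_zero_one (h : SatisfiesRTT Λ (fun l m => l ≠ m) RXXX T)
    (hl : l ∈ Λ) (hm : m ∈ Λ) (hne : l ≠ m) :
    T l 1 1 * T m 0 1 =
      fXXX l m • (T m 0 1 * T l 1 1) + (-gXXX l m) • (T l 0 1 * T m 1 1) := by
  have h' := congrFun (congrFun (h l m hl hm hne) (1, 0)) (1, 1)
  simp [Matrix.mul_apply, Fintype.sum_prod_type, embedR, aux1, aux2, RXXX, Rfg] at h'
  rw [← h']
  module

theorem SatisfiesRTT.zero_zero_mul_zero_one (h : SatisfiesRTT Λ (fun l m => l ≠ m) RXXX T)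
    (hl : l ∈ Λ) (hm : m ∈ Λ) (hne : l ≠ m) :
    T l 0 0 * T m 0 1 =
      fXXX m l • (T m 0 1 * T l 0 0) + gXXX l m • (T l 0 1 * T m 0 0) := by
  have h' := congrFun (congrFun (h m l hm hl hne.symm) (0, 0)) (1, 0)
  simp [Matrix.mul_apply, Fintype.sum_prod_type, embedR, aux1, aux2, RXXX, Rfg] at h'
  rw [h', gXXX_swap l m]
  module

theorem SatisfiesRTT.commute_zero_one (h : SatisfiesRTT Λ (fun l m => l ≠ m) RXXX T)
    (hl : l ∈ Λ) (hm : m ∈ Λ) : Commute (T l 0 1) (T m 0 1) := by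
  rcases eq_or_ne l m with rfl | hne
  · exact Commute.refl _
  have key : ∀ {x y : ℂ}, x ∈ Λ → y ∈ Λ → x ≠ y →
      fXXX x y • (T x 0 1 * T y 0 1) = fXXX x y • (T y 0 1 * T x 0 1) := by
    intro x y hx hy hxy
    have h' := congrFun (congrFun (h x y hx hy hxy) (0, 0)) (1, 1)
    simpa [Matrix.mul_apply, Fintype.sum_prod_type, embedR, aux1, aux2, RXXX, Rfg] using h'
  have h1 := key hl hm hne
  have h2 := key hm hl hne.symm
  rw [fXXX_eq_one_add_gXXX hne] at h1
  rw [fXXX_eq_one_add_gXXX hne.symm, gXXX_swap l m] at h2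
  show T l 0 1 * T m 0 1 = T m 0 1 * T l 0 1
  linear_combination (norm := module) (1 / 2 : ℂ) • h1 - (1 / 2 : ℂ) • h2

end RationalRTT

/-- two-component model, XXX case: the formal Bethe vector of the full
model expressed via the two components. -/
theorem two_component_Bethe_vectors_XXX {H : Type} [AddCommGroup H] [Module ℂ H]
    (Λ : Set ℂ)
    (T1 T2 : ℂ → Matrix (Fin 2) (Fin 2) (EndH H))
    (h1 : SatisfiesRTT Λ (fun lam mu => lam ≠ mu) RXXX T1)
    (h2 : SatisfiesRTT Λ (fun lam mu => lam ≠ mu) RXXX T2)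
    (hcomm : ∀ lam mu : ℂ, lam ∈ Λ → mu ∈ Λ →
      ∀ a b c d : Fin 2, Commute (T1 lam a b) (T2 mu c d))
    (v0 : H) (hv0 : v0 ≠ 0) (a1 d1 a2 d2 : ℂ → ℂ)
    (hA1 : ∀ lam : ℂ, lam ∈ Λ → T1 lam 0 0 v0 = a1 lam • v0)
    (hD1 : ∀ lam : ℂ, lam ∈ Λ → T1 lam 1 1 v0 = d1 lam • v0)
    (hC1 : ∀ lam : ℂ, lam ∈ Λ → T1 lam 1 0 v0 = 0)
    (hA2 : ∀ lam : ℂ, lam ∈ Λ → T2 lam 0 0 v0 = a2 lam • v0)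
    (hD2 : ∀ lam : ℂ, lam ∈ Λ → T2 lam 1 1 v0 = d2 lam • v0)
    (hC2 : ∀ lam : ℂ, lam ∈ Λ → T2 lam 1 0 v0 = 0)
    (M : ℕ) (lam : Fin M → ℂ) (hlam : ∀ i, lam i ∈ Λ)
    (hdist : Function.Injective lam) :
    ((List.ofFn (fun i : Fin M =>
        T1 (lam i) 0 0 * T2 (lam i) 0 1 + T1 (lam i) 0 1 * T2 (lam i) 1 1)).prod) v0
      = ∑ J : Finset (Fin M),
          (((∏ j ∈ J, ∏ k ∈ Jᶜ, fXXX (lam j) (lam k)) * (∏ j ∈ J, d2 (lam j)) *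
              (∏ k ∈ Jᶜ, a1 (lam k))) •
            ((finsetOpProd J (fun j => T1 (lam j) 0 1) *
                finsetOpProd Jᶜ (fun k => T2 (lam k) 0 1)) v0)) := by
  have hne : ∀ {i j : Fin M}, i ≠ j → lam i ≠ lam j := fun h => hdist.ne h
  rw [prod_ofFn_eq_finsetOpProd_univ,
    finsetOpProd_two_component (a := fun i => a1 (lam i)) (d := fun i => d2 (lam i))
      (f := fun i j => fXXX (lam i) (lam j)) (g := fun i j => gXXX (lam i) (lam j))
      (fun i j => h1.commute_zero_one (hlam i) (hlam j))
      (fun i j => h2.commute_zero_one (hlam i) (hlam j))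
      (fun i j => hcomm _ _ (hlam i) (hlam j) _ _ _ _)
      (fun i j => hcomm _ _ (hlam i) (hlam j) _ _ _ _)
      (fun i j => (hcomm _ _ (hlam j) (hlam i) _ _ _ _).symm)
      (fun i j h => h1.zero_zero_mul_zero_one (hlam i) (hlam j) (hne h))
      (fun i j h => h2.one_one_mul_zero_one (hlam i) (hlam j) (hne h)) ?_ ?_
      (fun i => hA1 _ (hlam i)) (fun i => hD2 _ (hlam i))]
  · simp [splitCoeff, Finset.compl_eq_univ_sdiff]
  · intro m k j hmk hmj hkj
    have h := gXXX_mul_gXXX (hne hmk) (hne hmj) (hne hkj)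
    rw [fXXX_eq_one_add_gXXX (hne hkj), fXXX_eq_one_add_gXXX (hne hmk.symm),
      gXXX_swap (lam m) (lam k)]
    linear_combination -h
  · intro m k j hmk hmj hkj
    have h := gXXX_mul_gXXX (hne hmk) (hne hmj) (hne hkj)
    rw [fXXX_eq_one_add_gXXX (hne hkj.symm), fXXX_eq_one_add_gXXX (hne hmk),
      gXXX_swap (lam k) (lam j)]
    linear_combination -h


end
end
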